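/- Theorem (bidiagonal case, part ii). If ℓ = 1 and t ≥ 1, then for every n ∈ ℕ the Toeplitz matrix 𝒯(c) of the n-th row sequence c k = M n k of the weighted lattice-path matrix M is totally positive. -/

import Mathlib

open Finset

/-- A multivariate polynomial with real coefficients is *nonnegative* if all of
its coefficients are nonnegative. -/
def PolyNonneg {σ : Type*} (p : MvPolynomial σ ℝ) : Prop :=
  ∀ m, 0 ≤ p.coeff m

/-- An `ℕ × ℕ` matrix with entries in `MvPolynomial σ ℝ` is *totally positive*
if every minor (taken along strictly increasing row and column indices) is a
nonnegative polynomial. -/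
def TP {σ : Type*} (A : ℕ → ℕ → MvPolynomial σ ℝ) : Prop :=
  ∀ r : ℕ, 1 ≤ r → ∀ ρ κ : Fin r → ℕ, StrictMono ρ → StrictMono κ →
    PolyNonneg (Matrix.of fun i j : Fin r => A (ρ i) (κ j)).det

/-- The weighted lattice-path matrix `M`:
`M n 0 = ∏_{i=1}^n b i`, `M n k = 0` for `k ≥ 1` and `n < t`, and
`M n k = Σ_{i=0}^{ℓ} (a n i) * M (n-t-i) (k-1) + (b n) * M (n-1) k`
for `n ≥ t`, `k ≥ 1`, where summands with a negative first index vanish. -/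
def latticeM {R : Type*} [CommRing R] (t ℓ : ℕ) (a : ℕ → ℕ → R) (b : ℕ → R) :
    ℕ → ℕ → R
  | n, 0 => ∏ i ∈ Finset.Icc 1 n, b i
  | 0, k + 1 => if t = 0 then a 0 0 * latticeM t ℓ a b 0 k else 0
  | n + 1, k + 1 =>
      if n + 1 < t then 0
      else (∑ i ∈ Finset.range (ℓ + 1),
              if t + i ≤ n + 1 then a (n + 1) i * latticeM t ℓ a b (n + 1 - t - i) k
              else 0)
        + b (n + 1) * latticeM t ℓ a b n (k + 1)
  termination_by n k => (k, n)

/-- The Toeplitz matrix of a sequence: `𝒯(c) i j = c (i - j)` for `i ≥ j`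
and `0` otherwise. -/
def toeplitz {R : Type*} [CommRing R] (c : ℕ → R) : ℕ → ℕ → R :=
  fun i j => if j ≤ i then c (i - j) else 0

namespace PolyNonneg

variable {σ : Type*}

lemma zero : PolyNonneg (0 : MvPolynomial σ ℝ) := fun m => by simp

lemma one : PolyNonneg (1 : MvPolynomial σ ℝ) := fun m => by
  classical
  rw [MvPolynomial.coeff_one]
  split_ifs <;> norm_num

lemma mul {p q : MvPolynomial σ ℝ} (hp : PolyNonneg p) (hq : PolyNonneg q) :
    PolyNonneg (p * q) := fun m => by
  classical
  rw [MvPolynomial.coeff_mul]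
  exact Finset.sum_nonneg fun x _ => mul_nonneg (hp _) (hq _)

lemma sum {ι : Type*} (s : Finset ι) {f : ι → MvPolynomial σ ℝ}
    (h : ∀ i ∈ s, PolyNonneg (f i)) : PolyNonneg (∑ i ∈ s, f i) := fun m => by
  rw [MvPolynomial.coeff_sum]
  exact Finset.sum_nonneg fun i hi => h i hi m

lemma prod {ι : Type*} (s : Finset ι) {f : ι → MvPolynomial σ ℝ}
    (h : ∀ i ∈ s, PolyNonneg (f i)) : PolyNonneg (∏ i ∈ s, f i) :=
  Finset.prod_induction f PolyNonneg (fun _ _ => mul) one h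

end PolyNonneg

/-- If every row of the family `F` is a nonnegative combination of rows of the family `G`, and
the supports of these combinations are weakly ordered from left to right, then nonnegativity of
the maximal minors passes from `G` to `F`. -/
lemma polyNonneg_det_of_noncrossing {σ : Type*} {r : ℕ}
    {F G : ℤ → Fin r → MvPolynomial σ ℝ} (S : ℤ → Finset ℤ)
    (w : ℤ → ℤ → MvPolynomial σ ℝ) (hw : ∀ x y, PolyNonneg (w x y))
    (hS : ∀ x x', x < x' → ∀ y ∈ S x, ∀ y' ∈ S x', y ≤ y')
    (hF : ∀ x, F x = ∑ y ∈ S x, w x y • G y)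
    (hG : ∀ y : Fin r → ℤ, StrictMono y → PolyNonneg (Matrix.of fun i => G (y i)).det)
    (x : Fin r → ℤ) (hx : StrictMono x) :
    PolyNonneg (Matrix.of fun i => F (x i)).det := by
  have expand : (Matrix.of fun i => F (x i)).det =
      ∑ y ∈ Fintype.piFinset fun i => S (x i),
        (∏ i, w (x i) (y i)) * (Matrix.of fun i => G (y i)).det := by
    have h := (Matrix.detRowAlternating (R := MvPolynomial σ ℝ)
      (n := Fin r)).toMultilinearMap.map_sum_finset
      (fun i y => w (x i) y • G y) (fun i => S (x i))
    simp only [← hF, MultilinearMap.map_smul_univ] at h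
    exact h
  rw [expand]
  refine PolyNonneg.sum _ fun y hy => ?_
  rw [Fintype.mem_piFinset] at hy
  refine (PolyNonneg.prod _ fun i _ => hw _ _).mul ?_
  have hmono : Monotone y := fun i j hij => by
    rcases hij.eq_or_lt with rfl | h
    · exact le_rfl
    · exact hS _ _ (hx h) _ (hy i) _ (hy j)
  by_cases hinj : Function.Injective y
  · exact hG y (hmono.strictMono_of_injective hinj)
  · simp only [Function.Injective, not_forall] at hinj
    obtain ⟨i, j, hij, hne⟩ := hinj
    rw [Matrix.det_zero_of_row_eq hne (by ext k; simp [hij])]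
    exact PolyNonneg.zero

/-- The weighted lattice-path matrix, extended by zero to negative indices. -/
def latticeMInt {R : Type*} [CommRing R] (t : ℕ) (a : ℕ → ℕ → R) (b : ℕ → R) (m k : ℤ) : R :=
  if 0 ≤ m ∧ 0 ≤ k then latticeM t 1 a b m.toNat k.toNat else 0

lemma latticeMInt_natCast {R : Type*} [CommRing R] (t : ℕ) (a : ℕ → ℕ → R) (b : ℕ → R)
    (m k : ℕ) : latticeMInt t a b m k = latticeM t 1 a b m k := by
  simp [latticeMInt]

lemma latticeMInt_of_neg_left {R : Type*} [CommRing R] (t : ℕ) (a : ℕ → ℕ → R) (b : ℕ → R)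
    {m : ℤ} (hm : m < 0) (k : ℤ) : latticeMInt t a b m k = 0 :=
  if_neg fun h => by omega

lemma latticeMInt_of_neg_right {R : Type*} [CommRing R] (t : ℕ) (a : ℕ → ℕ → R) (b : ℕ → R)
    (m : ℤ) {k : ℤ} (hk : k < 0) : latticeMInt t a b m k = 0 :=
  if_neg fun h => by omega

lemma latticeMInt_zero_left {R : Type*} [CommRing R] {t : ℕ} (ht : 1 ≤ t) (a : ℕ → ℕ → R)
    (b : ℕ → R) (k : ℤ) : latticeMInt t a b 0 k = if k = 0 then 1 else 0 := by
  rcases lt_or_ge k 0 with hk | hk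
  · rw [latticeMInt_of_neg_right _ _ _ _ hk, if_neg hk.ne]
  · lift k to ℕ using hk
    rw [← Nat.cast_zero, latticeMInt_natCast]
    cases k with
    | zero => simp [latticeM]
    | succ k =>
      rw [latticeM, if_neg (by omega), if_neg (by push_cast; omega)]

lemma latticeM_eq_zero_of_lt {R : Type*} [CommRing R] {t ℓ : ℕ} (a : ℕ → ℕ → R) (b : ℕ → R)
    {n k : ℕ} (hn : n < t) (hk : k ≠ 0) : latticeM t ℓ a b n k = 0 := by
  obtain ⟨k, rfl⟩ := Nat.exists_eq_succ_of_ne_zero hk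
  cases n with
  | zero => rw [latticeM, if_neg (by omega)]
  | succ n => rw [latticeM, if_pos hn]

lemma latticeMInt_succ {R : Type*} [CommRing R] (t : ℕ) (a : ℕ → ℕ → R) (b : ℕ → R)
    (n : ℕ) (k : ℤ) :
    latticeMInt t a b (n + 1) k = b (n + 1) * latticeMInt t a b n k
      + a (n + 1) 0 * latticeMInt t a b (n + 1 - t) (k - 1)
      + a (n + 1) 1 * latticeMInt t a b (n - t) (k - 1) := by
  rcases lt_or_ge k 0 with hk | hk
  · simp [latticeMInt_of_neg_right, hk, show k - 1 < 0 by omega]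
  lift k to ℕ using hk
  have shift (i m : ℕ) (x : ℤ) (hx : x = n + 1 - t - i) :
      (if t + i ≤ n + 1 then a (n + 1) i * latticeM t 1 a b (n + 1 - t - i) m else 0) =
        a (n + 1) i * latticeMInt t a b x m := by
    split_ifs with h
    · rw [show x = ((n + 1 - t - i : ℕ) : ℤ) by omega, latticeMInt_natCast]
    · rw [latticeMInt_of_neg_left _ _ _ (by omega), mul_zero]
  rw [show (n : ℤ) + 1 = ((n + 1 : ℕ) : ℤ) by push_cast; rfl, latticeMInt_natCast,
    latticeMInt_natCast]
  cases k with
  | zero =>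
    rw [latticeMInt_of_neg_right _ _ _ _ (by simp), latticeMInt_of_neg_right _ _ _ _ (by simp),
      latticeM, latticeM, Finset.prod_Icc_succ_top (by omega)]
    ring
  | succ k =>
    rw [show ((k + 1 : ℕ) : ℤ) - 1 = k by push_cast; ring]
    rcases lt_or_ge (n + 1) t with h | h
    · rw [latticeM_eq_zero_of_lt _ _ h (by omega), latticeM_eq_zero_of_lt _ _ (by omega) (by omega),
        latticeMInt_of_neg_left _ _ _ (by omega), latticeMInt_of_neg_left _ _ _ (by omega)]
      ring
    · rw [latticeM, if_neg (by omega), Finset.sum_range_succ, Finset.sum_range_one,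
        shift 0 k (((n + 1 : ℕ) : ℤ) - t) (by push_cast; ring),
        shift 1 k ((n : ℤ) - t) (by push_cast; ring)]
      ring

/-- The lattice points `(m, k)` with `N - t ≤ m ≤ N` are parametrised by `x = k * (t + 1) - m`.
The row of the point with parameter `x` lists the weights of the paths from that point to the
points `(0, κ j)`. -/
def frontierRow {R : Type*} [CommRing R] (t : ℕ) (a : ℕ → ℕ → R) (b : ℕ → R) {r : ℕ}
    (κ : Fin r → ℕ) (N : ℕ) (x : ℤ) (j : Fin r) : R :=
  latticeMInt t a b (N - (N + x) % (t + 1)) ((N + x) / (t + 1) - κ j)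

lemma frontierRow_eq {R : Type*} [CommRing R] {t : ℕ} (a : ℕ → ℕ → R) (b : ℕ → R) {r : ℕ}
    (κ : Fin r → ℕ) {N : ℕ} {x : ℤ} (q s : ℤ) (hs : 0 ≤ s) (hst : s ≤ t)
    (h : N + x = q * (t + 1) + s) (j : Fin r) :
    frontierRow t a b κ N x j = latticeMInt t a b (N - s) (q - κ j) := by
  have hmod : ((N : ℤ) + x) % (t + 1) = s := by
    rw [h, add_comm, Int.add_mul_emod_self_right, Int.emod_eq_of_lt hs (by omega)]
  have hdiv : ((N : ℤ) + x) / (t + 1) = q := by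
    rw [h, add_comm, Int.add_mul_ediv_right _ _ (by omega), Int.ediv_eq_zero_of_lt hs (by omega),
      zero_add]
  rw [frontierRow, hmod, hdiv]

lemma frontierRow_succ_of_dvd {R : Type*} [CommRing R] {t : ℕ} (ht : 1 ≤ t) (a : ℕ → ℕ → R)
    (b : ℕ → R) {r : ℕ} (κ : Fin r → ℕ) {N : ℕ} {x : ℤ} (hx : (t + 1 : ℤ) ∣ N + 1 + x) :
    frontierRow t a b κ (N + 1) x = b (N + 1) • frontierRow t a b κ N (x + 1)
      + a (N + 1) 0 • frontierRow t a b κ N (x - 1) + a (N + 1) 1 • frontierRow t a b κ N x := by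
  obtain ⟨q, hq⟩ := hx
  ext1 j
  simp only [Pi.add_apply, Pi.smul_apply, smul_eq_mul]
  rw [frontierRow_eq a b κ q 0 le_rfl (by omega) (by push_cast; linarith) j,
    frontierRow_eq a b κ q 0 le_rfl (by omega) (by linarith) j,
    frontierRow_eq a b κ (q - 1) (t - 1) (by omega) (by omega) (by linarith) j,
    frontierRow_eq a b κ (q - 1) t (by omega) (by omega) (by linarith) j]
  have h := latticeMInt_succ t a b N (q - κ j)
  convert h using 4 <;> push_cast <;> ring_nf

lemma frontierRow_succ_of_not_dvd {R : Type*} [CommRing R] {t : ℕ} (a : ℕ → ℕ → R)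
    (b : ℕ → R) {r : ℕ} (κ : Fin r → ℕ) {N : ℕ} {x : ℤ} (hx : ¬ (t + 1 : ℤ) ∣ N + 1 + x) :
    frontierRow t a b κ (N + 1) x = frontierRow t a b κ N x := by
  have hpos : (0 : ℤ) < t + 1 := by omega
  have h0 := Int.emod_nonneg ((N : ℤ) + 1 + x) hpos.ne'
  have h1 := Int.emod_lt_of_pos ((N : ℤ) + 1 + x) hpos
  have h2 : ((N : ℤ) + 1 + x) % (t + 1) ≠ 0 := fun h => hx (Int.dvd_of_emod_eq_zero h)
  have h3 := Int.mul_ediv_add_emod ((N : ℤ) + 1 + x) (t + 1)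
  generalize ((N : ℤ) + 1 + x) % (t + 1) = s at *
  generalize ((N : ℤ) + 1 + x) / (t + 1) = q at *
  ext1 j
  rw [frontierRow_eq a b κ q s h0 (by omega) (by push_cast; linarith) j,
    frontierRow_eq a b κ q (s - 1) (by omega) (by omega) (by linarith) j]
  congr 1
  push_cast
  ring

lemma frontierRow_zero {R : Type*} [CommRing R] {t : ℕ} (ht : 1 ≤ t) (a : ℕ → ℕ → R)
    (b : ℕ → R) {r : ℕ} (κ : Fin r → ℕ) (x : ℤ) (j : Fin r) :
    frontierRow t a b κ 0 x j = if x = κ j * (t + 1) then 1 else 0 := by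
  have hpos : (0 : ℤ) < t + 1 := by omega
  have h0 := Int.emod_nonneg x hpos.ne'
  have h3 := Int.mul_ediv_add_emod x (t + 1)
  rw [frontierRow, Nat.cast_zero, zero_add]
  by_cases h : x % (t + 1) = 0
  · rw [h, sub_zero, latticeMInt_zero_left ht]
    refine if_congr ?_ rfl rfl
    rw [sub_eq_zero, Int.ediv_eq_iff_eq_mul_left hpos.ne' (Int.dvd_of_emod_eq_zero h)]
  · rw [latticeMInt_of_neg_left _ _ _ (by omega), if_neg]
    rintro rfl
    simp at h

/-- The incidence matrix of two strictly increasing sequences has a nonnegative determinant. -/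
lemma polyNonneg_det_incidence {σ : Type*} {r : ℕ} {x y : Fin r → ℤ} (hx : StrictMono x)
    (hy : StrictMono y) :
    PolyNonneg (Matrix.of fun i j => if x i = y j then (1 : MvPolynomial σ ℝ) else 0).det := by
  by_cases h : ∀ i, ∃ j, x i = y j
  · choose f hf using h
    have hfmono : StrictMono f := fun i j hij => hy.lt_iff_lt.1 (by
      rw [← hf, ← hf]
      exact hx hij)
    have hfid : f = id := by
      simpa using hfmono.range_inj strictMono_id |>.1
        (by simpa using (Finite.injective_iff_surjective.1 hfmono.injective).range_eq)
    have hone : (Matrix.of fun i j => if x i = y j then (1 : MvPolynomial σ ℝ) else 0) = 1 := by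
      ext1 i j
      rw [Matrix.of_apply, hf, hfid, Matrix.one_apply]
      exact if_congr hy.injective.eq_iff rfl rfl
    rw [hone, Matrix.det_one]
    exact PolyNonneg.one
  · push Not at h
    obtain ⟨i, hi⟩ := h
    rw [Matrix.det_eq_zero_of_row_eq_zero i fun j => by simp [hi j]]
    exact PolyNonneg.zero

lemma polyNonneg_det_frontierRow {σ : Type*} {t : ℕ} (ht : 1 ≤ t)
    {a : ℕ → ℕ → MvPolynomial σ ℝ} {b : ℕ → MvPolynomial σ ℝ}
    (ha : ∀ n i, i ≤ 1 → PolyNonneg (a n i)) (hb : ∀ n, PolyNonneg (b n))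
    {r : ℕ} {κ : Fin r → ℕ} (hκ : StrictMono κ) (N : ℕ) (x : Fin r → ℤ) (hx : StrictMono x) :
    PolyNonneg (Matrix.of fun i => frontierRow t a b κ N (x i)).det := by
  induction N generalizing x with
  | zero =>
    have hκ' : StrictMono fun j => (κ j : ℤ) * (t + 1) := fun i j hij =>
      mul_lt_mul_of_pos_right (by exact_mod_cast hκ hij) (by omega)
    convert polyNonneg_det_incidence (σ := σ) hx hκ' using 4
    ext1 j
    exact frontierRow_zero ht a b κ _ j
  | succ N ih =>
    refine polyNonneg_det_of_noncrossing
      (fun x => if (t + 1 : ℤ) ∣ N + 1 + x then {x + 1, x - 1, x} else {x})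
      (fun x y => if (t + 1 : ℤ) ∣ N + 1 + x then
        (if y = x + 1 then b (N + 1) else if y = x - 1 then a (N + 1) 0 else a (N + 1) 1) else 1)
      (fun x y => ?_) (fun x x' hlt y hy y' hy' => ?_) (fun x => ?_) ih x hx
    · split_ifs
      exacts [hb _, ha _ _ zero_le_one, ha _ _ le_rfl, PolyNonneg.one]
    · have hgap (h : (t + 1 : ℤ) ∣ N + 1 + x) (h' : (t + 1 : ℤ) ∣ N + 1 + x') : x + 2 ≤ x' := by
        have := Int.le_of_dvd (by omega) (dvd_sub h' h)
        omega
      split_ifs at hy hy' <;> simp only [Finset.mem_insert, Finset.mem_singleton] at hy hy'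
      · have := hgap ‹_› ‹_›
        omega
      all_goals omega
    · split_ifs with h
      · rw [frontierRow_succ_of_dvd ht a b κ h,
          Finset.sum_insert (by simp; omega), Finset.sum_insert (by simp), Finset.sum_singleton,
          if_pos rfl, if_neg (by omega), if_pos rfl, if_neg (by omega), if_neg (by omega), add_assoc]
      · rw [frontierRow_succ_of_not_dvd a b κ h, Finset.sum_singleton, one_smul]

/-- **Theorem (bidiagonal case, part ii).**  If `ℓ = 1` and `t ≥ 1`, then for
every `n` the Toeplitz matrix of the `n`-th row sequence `k ↦ M n k` of the
weighted lattice-path matrix `M` is totally positive. -/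
theorem toeplitz_row_latticeM_totallyPositive_of_ell_eq_one
    {σ : Type*} (t : ℕ) (ht : 1 ≤ t)
    (a : ℕ → ℕ → MvPolynomial σ ℝ) (b : ℕ → MvPolynomial σ ℝ)
    (ha : ∀ n i, i ≤ 1 → PolyNonneg (a n i)) (hb : ∀ n, PolyNonneg (b n))
    (n : ℕ) :
    TP (toeplitz fun k => latticeM t 1 a b n k) := by
  intro r _ ρ κ hρ hκ
  have hmono : StrictMono fun i => (ρ i : ℤ) * (t + 1) - n := fun i j hij =>
    sub_lt_sub_right (mul_lt_mul_of_pos_right (by exact_mod_cast hρ hij) (by omega)) _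
  convert polyNonneg_det_frontierRow ht ha hb hκ n _ hmono using 4 with i
  ext1 j
  rw [frontierRow_eq a b κ (ρ i) 0 le_rfl (by omega) (by ring), sub_zero, toeplitz]
  split_ifs with h
  · rw [← Nat.cast_sub h, latticeMInt_natCast]
  · rw [latticeMInt_of_neg_right _ _ _ _ (by omega)]
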